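/- Let p be a prime, K a field, and ρ, q elements of K with ρ^j ≠ q^j for all 1 ≤ j ≤ n. Then the p-adic (ρ,q)-gamma value at n+1 satisfies Γ^p_{ρ,q}(n+1) = (−1)^{n+1} [n]!_{ρ,q} / ([p]_{ρ,q}^{⌊n/p⌋} · [⌊n/p⌋]!_{ρ^p,q^p}); equivalently, ∏_{1≤j≤n, p∤j} [j]_{ρ,q} = [n]!_{ρ,q} / ([p]_{ρ,q}^{⌊n/p⌋} · [⌊n/p⌋]!_{ρ^p,q^p}), where ⌊·⌋ is the floor function and [m]!_{ρ^p,q^p} is the (ρ^p,q^p)-factorial. -/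

import Mathlib

/-- The `(ρ,q)`-number `[n]_{ρ,q} = (ρⁿ − qⁿ)/(ρ − q)`. -/
noncomputable def pqNum {K : Type*} [Field K] (ρ q : K) (n : ℕ) : K :=
  (ρ ^ n - q ^ n) / (ρ - q)

/-- The `(ρ,q)`-factorial `[n]!_{ρ,q} = ∏_{j=1}^{n} [j]_{ρ,q}`. -/
noncomputable def pqFactorial {K : Type*} [Field K] (ρ q : K) (n : ℕ) : K :=
  ∏ j ∈ Finset.range n, pqNum ρ q (j + 1)

/-- The `p`-adic `(ρ,q)`-gamma function at natural-number arguments: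
`Γ^p_{ρ,q}(n) = (−1)ⁿ ∏_{1≤j<n, p∤j} [j]_{ρ,q}`. -/
noncomputable def padicPqGamma {K : Type*} [Field K] (p : ℕ) (ρ q : K) (n : ℕ) : K :=
  (-1) ^ n * ∏ j ∈ (Finset.range n).filter (fun j => ¬ p ∣ j), pqNum ρ q j

theorem pqNum_ne_zero {K : Type*} [Field K] {ρ q : K} {n : ℕ} (h₁ : ρ ≠ q)
    (hn : ρ ^ n ≠ q ^ n) : pqNum ρ q n ≠ 0 :=
  div_ne_zero (sub_ne_zero.2 hn) (sub_ne_zero.2 h₁)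

theorem pqNum_mul_pqNum_pow {K : Type*} [Field K] {ρ q : K} {p : ℕ} (hp : ρ ^ p ≠ q ^ p) (m : ℕ) :
    pqNum ρ q p * pqNum (ρ ^ p) (q ^ p) m = pqNum ρ q (p * m) := by
  have := sub_ne_zero.2 hp
  rw [pqNum, pqNum, pqNum, ← pow_mul, ← pow_mul, mul_comm, div_mul_div_cancel₀ this]

theorem pqFactorial_succ {K : Type*} [Field K] (ρ q : K) (n : ℕ) :
    pqFactorial ρ q (n + 1) = pqFactorial ρ q n * pqNum ρ q (n + 1) :=
  Finset.prod_range_succ _ _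

theorem prod_not_dvd_pqNum_mul {K : Type*} [Field K] {p : ℕ} (ρ q : K) (n : ℕ)
    (h : ∀ j : ℕ, 1 ≤ j → j ≤ n → ρ ^ j ≠ q ^ j) :
    (∏ j ∈ (Finset.range (n + 1)).filter (fun j => ¬ p ∣ j), pqNum ρ q j) *
      (pqNum ρ q p ^ (n / p) * pqFactorial (ρ ^ p) (q ^ p) (n / p)) = pqFactorial ρ q n := by
  induction n with
  | zero => simp [pqFactorial, Finset.filter_singleton]
  | succ n ih =>
    specialize ih fun j h₁ h₂ => h j h₁ (h₂.trans n.le_succ)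
    rw [Finset.range_add_one, Finset.filter_insert, pqFactorial_succ, ← ih]
    by_cases hd : p ∣ n + 1
    · have hpow := h p (Nat.pos_of_dvd_of_pos hd n.succ_pos) (Nat.le_of_dvd n.succ_pos hd)
      have hm := pqNum_mul_pqNum_pow hpow (n / p + 1)
      have hn : p * (n / p + 1) = n + 1 := by
        rw [← Nat.succ_div_of_dvd hd, Nat.mul_div_cancel' hd]
      rw [hn] at hm
      rw [if_neg (not_not.2 hd), Nat.succ_div_of_dvd hd, pqFactorial_succ, ← hm]
      ring
    · rw [if_pos hd, Nat.succ_div_of_not_dvd hd, Finset.prod_insert (by simp)]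
      ring

/-- `Γ^p_{ρ,q}(n+1) = (−1)^{n+1} [n]!_{ρ,q} / ([p]_{ρ,q}^{⌊n/p⌋} [⌊n/p⌋]!_{ρ^p,q^p})`. -/
theorem padic_pq_gamma_closed_form
    (p : ℕ) (hp : p.Prime) (K : Type*) [Field K] (ρ q : K) (n : ℕ)
    (h : ∀ j : ℕ, 1 ≤ j → j ≤ n → ρ ^ j ≠ q ^ j) :
    padicPqGamma p ρ q (n + 1) =
      (-1) ^ (n + 1) *
        (pqFactorial ρ q n /
          (pqNum ρ q p ^ (n / p) * pqFactorial (ρ ^ p) (q ^ p) (n / p))) := by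
  rw [padicPqGamma, ← prod_not_dvd_pqNum_mul (p := p) ρ q n h, mul_div_cancel_right₀]
  rcases lt_or_ge n p with hn | hn
  · simp [Nat.div_eq_of_lt hn, pqFactorial]
  have hpow := h p hp.one_le hn
  have hone : ρ ≠ q := fun e => hpow (by rw [e])
  refine mul_ne_zero (pow_ne_zero _ (pqNum_ne_zero hone hpow)) (Finset.prod_ne_zero_iff.2 ?_)
  intro j hj
  refine pqNum_ne_zero hpow ?_
  rw [← pow_mul, ← pow_mul]
  refine h _ (Nat.mul_pos hp.pos j.succ_pos) ?_
  exact (Nat.mul_le_mul_left p (Finset.mem_range.1 hj)).trans (Nat.mul_div_le n p)
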